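/- Let F be a field, n ≥ 1, and let V ⊆ F^n be a finite set of points. Suppose there exists a subgroup G of the group of invertible affine transformations of F^n such that every element of G maps V onto V and G acts transitively on V. Let k ≥ 0 be a non-negative integer such that C(n+k, n) < |V|. Then for EVERY point v ∈ V, every almost cover of V and v consists of more than k affine hyperplanes. -/

import Mathlib

/-- An affine hyperplane in `F^n`: the solution set `{x | ∑ i, a i * x i = c}`
of a degree-one equation, where the linear functional `a` is nonzero. -/
def IsAffineHyperplane {F : Type*} [Field F] {n : ℕ} (H : Set (Fin n → F)) : Prop :=
  ∃ (a : Fin n → F) (c : F), a ≠ 0 ∧ H = {x : Fin n → F | ∑ i, a i * x i = c}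

/-- An affine hyperplane is the zero set of an affine map to the base field. -/
theorem IsAffineHyperplane.exists_affineMap {F : Type*} [Field F] {n : ℕ}
    {H : Set (Fin n → F)} (hH : IsAffineHyperplane H) :
    ∃ φ : (Fin n → F) →ᵃ[F] F, ∀ x, x ∈ H ↔ φ x = 0 := by
  obtain ⟨a, c, -, rfl⟩ := hH
  refine ⟨(∑ i, a i • LinearMap.proj (R := F) (φ := fun _ : Fin n => F) i).toAffineMap
    - AffineMap.const F _ c, fun x => ?_⟩
  simp [sub_eq_zero]

/-- The `k`-th power of the span of a family indexed by `ι` has dimension at most the number of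
multisets of size `k` on `ι`. -/
theorem Submodule.finrank_span_range_pow_le {F A ι : Type*} [Field F] [CommRing A] [Algebra F A]
    [Fintype ι] [DecidableEq ι] (s : ι → A) (k : ℕ) :
    Module.finrank F ↥(Submodule.span F (Set.range s) ^ k) ≤
      (Fintype.card ι + k - 1).choose k := by
  let p : Sym ι k → A := fun t => ((t : Multiset ι).map s).prod
  have hle : Submodule.span F (Set.range s) ^ k ≤ Submodule.span F (Set.range p) := by
    rw [Submodule.span_pow]
    refine Submodule.span_mono fun a ha => ?_
    obtain ⟨f, rfl⟩ := Set.mem_pow.mp ha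
    choose e he using fun i => (f i).2
    refine ⟨Sym.mk (List.ofFn e : Multiset ι) (by simp), ?_⟩
    simp [p, List.map_ofFn, Function.comp_def, he]
  have : Module.Finite F ↥(Submodule.span F (Set.range p)) :=
    Module.Finite.span_of_finite F (Set.finite_range p)
  calc _ ≤ Module.finrank F ↥(Submodule.span F (Set.range p)) := Submodule.finrank_mono hle
    _ ≤ Fintype.card (Sym ι k) := finrank_range_le_card p
    _ = _ := Sym.card_sym_eq_choose k

theorem Submodule.prod_mem_pow_card {F A ι : Type*} [CommSemiring F] [CommSemiring A] [Algebra F A]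
    (W : Submodule F A) (t : Finset ι) (f : ι → A) (hf : ∀ i ∈ t, f i ∈ W) :
    ∏ i ∈ t, f i ∈ W ^ t.card := by
  classical
  induction t using Finset.induction_on with
  | empty => simpa using Submodule.one_le.mp (le_refl (1 : Submodule F A))
  | insert i t hi ih =>
    rw [Finset.prod_insert hi, Finset.card_insert_of_notMem hi, pow_succ']
    exact Submodule.mul_mem_mul (hf i (Finset.mem_insert_self i t))
      (ih fun j hj => hf j (Finset.mem_insert_of_mem hj))

/-- The constant function `1` (at `none`) and the coordinate functions, restricted to `V`. -/
def affineCoordinate {F : Type*} [Field F] {n : ℕ} (V : Finset (Fin n → F)) :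
    Option (Fin n) → V → F
  | none => 1
  | some i => fun x => x.1 i

theorem AffineMap.restrict_mem_span_affineCoordinate {F : Type*} [Field F] {n : ℕ}
    (V : Finset (Fin n → F)) (φ : (Fin n → F) →ᵃ[F] F) :
    (fun x : V => φ x) ∈ Submodule.span F (Set.range (affineCoordinate V)) := by
  have h : (fun x : V => φ x) =
      ∑ i, φ.linear (fun j => if i = j then 1 else 0) • affineCoordinate V (some i)
      + φ 0 • affineCoordinate V none := by
    ext x
    rw [congrFun φ.decomp x, Pi.add_apply, φ.linear.pi_apply_eq_sum_univ]
    simp [affineCoordinate, mul_comm]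
  rw [h]
  exact add_mem (sum_mem fun i _ => Submodule.smul_mem _ _ (Submodule.subset_span ⟨_, rfl⟩))
    (Submodule.smul_mem _ _ (Submodule.subset_span ⟨_, rfl⟩))

/-- If a subgroup of the group of invertible affine transformations of `F^n`
preserves the finite set `V` and acts transitively on it, and
`C(n+k, n) < |V|`, then for every point `v ∈ V`, every almost cover of `V` and
`v` consists of more than `k` affine hyperplanes. -/
theorem almost_cover_lower_bound_transitive {F : Type*} [Field F] {n : ℕ} (hn : 1 ≤ n)
    (V : Finset (Fin n → F))
    (G : Subgroup ((Fin n → F) ≃ᵃ[F] (Fin n → F)))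
    (hGV : ∀ g ∈ G, (⇑g) '' (↑V : Set (Fin n → F)) = ↑V)
    (hGtrans : ∀ v ∈ V, ∀ w ∈ V, ∃ g ∈ G, g v = w)
    (k : ℕ) (hk : (n + k).choose n < V.card) :
    ∀ v ∈ V, ∀ (m : ℕ) (H : Fin m → Set (Fin n → F)),
      (∀ j, IsAffineHyperplane (H j)) →
      (↑V \ {v} : Set (Fin n → F)) ⊆ ⋃ j, H j →
      v ∉ ⋃ j, H j → k < m := by
  intro v hv m H hH hcover hvH
  by_contra! hmk
  choose φ hφ using fun j => (hH j).exists_affineMap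
  classical
  set W := Submodule.span F (Set.range (affineCoordinate V))
  have hW : (1 : Submodule F (V → F)) ≤ W :=
    Submodule.one_le.mpr (Submodule.subset_span ⟨none, rfl⟩)
  have hsingle (w : V) : Pi.single w (1 : F) ∈ W ^ k := by
    obtain ⟨g, hg, hgw⟩ := hGtrans w w.2 v hv
    have hprod : (∏ j, fun x : V => φ j (g x)) ∈ W ^ k := by
      refine pow_le_pow_right₀ hW hmk ?_
      simpa using Submodule.prod_mem_pow_card W Finset.univ (fun j (x : V) => φ j (g x)) fun j _ =>
        ((φ j).comp g.toAffineMap).restrict_mem_span_affineCoordinate V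
    have hne : ∏ j, φ j v ≠ 0 := Finset.prod_ne_zero_iff.mpr fun j _ h =>
      hvH (Set.mem_iUnion.mpr ⟨j, (hφ j v).mpr h⟩)
    convert Submodule.smul_mem _ (∏ j, φ j v)⁻¹ hprod using 1
    ext x
    by_cases hx : x = w
    · subst hx
      simp [hgw, hne]
    · have hgx : g x ∈ (V : Set (Fin n → F)) \ {v} := by
        refine ⟨hGV g hg ▸ Set.mem_image_of_mem g x.2, fun h => hx (Subtype.ext ?_)⟩
        exact g.injective (h.trans hgw.symm)
      obtain ⟨j, hj⟩ := Set.mem_iUnion.mp (hcover hgx)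
      have hzero : ∏ j, φ j (g x) = 0 :=
        Finset.prod_eq_zero (Finset.mem_univ j) ((hφ j _).mp hj)
      simp [hx, hzero]
  have htop : W ^ k = ⊤ := by
    rw [eq_top_iff, ← (Pi.basisFun F V).span_eq, Submodule.span_le]
    rintro _ ⟨w, rfl⟩
    simpa using hsingle w
  have hdim := Submodule.finrank_span_range_pow_le (F := F) (affineCoordinate V) k
  rw [show Submodule.span F (Set.range (affineCoordinate V)) ^ k = ⊤ from htop,
    finrank_top] at hdim
  simp only [Module.finrank_fintype_fun_eq_card, Fintype.card_coe, Fintype.card_option,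
    Fintype.card_fin, show n + 1 + k - 1 = n + k by omega] at hdim
  rw [← Nat.choose_symm_add] at hdim
  omega
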